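/- arXiv:2208.11322 — 15 statements merged into one kernel-verified Lean document; each statement's English description precedes it below -/
import Mathlib

section
/- Let p be a complex polynomial, let λ ∈ ℂ \ {0}, and let T(z) = az + b be an affine map with a ≠ 0. Set g = λ·(p ∘ T). Then for every z ∈ ℂ with p'(T(z)) ≠ 0, one has C_g(z) = T⁻¹(C_p(T(z))), i.e. C_g(z) = (C_p(az + b) − b)/a. (The Scaling theorem for Chebyshev's method.) -/
open Polynomial

/-- Chebyshev's method of a complex polynomial `p`:
`C_p(z) = z - (1 + L_p(z)/2) * p(z)/p'(z)` where `L_p(z) = p(z) p''(z) / p'(z)^2`. -/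
noncomputable def cheb (p : Polynomial ℂ) (z : ℂ) : ℂ :=
  z - (1 + (eval z p * eval z (derivative (derivative p))
        / (eval z (derivative p)) ^ 2) / 2)
    * (eval z p / eval z (derivative p))

/-- The Scaling theorem for Chebyshev's method: if `T(z) = a z + b` is affine
(`a ≠ 0`), `λ ≠ 0` and `g = λ · (p ∘ T)`, then `C_g(z) = T⁻¹(C_p(T z))` whenever
`p'(T z) ≠ 0`. -/
theorem chebyshev_scaling (p : Polynomial ℂ) (lam a b : ℂ) (hlam : lam ≠ 0)
    (ha : a ≠ 0) (g : Polynomial ℂ)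
    (hg : g = C lam * (p.comp (C a * X + C b))) :
    ∀ z : ℂ, eval (a * z + b) (derivative p) ≠ 0 →
      cheb g z = (cheb p (a * z + b) - b) / a := by
  intro z hz
  have hderiv : derivative g = C (lam * a) * ((derivative p).comp (C a * X + C b)) := by
    simp [hg, derivative_comp]
    ring
  have hderiv_deriv : derivative (derivative g)
      = C (lam * a ^ 2) * ((derivative (derivative p)).comp (C a * X + C b)) := by
    simp [hderiv, derivative_comp]
    ring
  unfold cheb
  rw [hderiv_deriv, hderiv, hg]
  simp only [eval_mul, eval_C, eval_comp, eval_add, eval_X]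
  field_simp
  ring
end

section
/- Let p be a complex polynomial of degree d and let λ ∈ ℂ \ {0} satisfy p(λz) = λ^d · p(z) for all z ∈ ℂ. Then for every z ∈ ℂ with p'(z) ≠ 0, one has C_p(λz) = λ·C_p(z); that is, C_p commutes with the rotational symmetry z ↦ λz of p. -/
open Polynomial

/-- Differentiating a scaling relation `c * p(a x) = b * p(x)` multiplies its left side by `a`. -/
theorem mul_derivative_comp_C_mul_X {R : Type*} [CommRing R] {p : Polynomial R} {a b c : R}
    (h : C c * p.comp (C a * X) = C b * p) :
    C (c * a) * (derivative p).comp (C a * X) = C b * derivative p := by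
  have h' := congrArg derivative h
  simp only [derivative_mul, derivative_comp, derivative_C, derivative_X, zero_mul, zero_add,
    mul_one] at h'
  rw [← h', C_mul]
  ring

/-- If `p` has degree `d` and `p(λ z) = λ^d p(z)` for a nonzero `λ`, then
Chebyshev's method commutes with the rotational symmetry `z ↦ λ z` of `p`:
`C_p(λ z) = λ C_p(z)` wherever `p'(z) ≠ 0`. -/
theorem chebyshev_commutes_with_symmetry (p : Polynomial ℂ) (d : ℕ)
    (hd : p.natDegree = d) (lam : ℂ) (hlam : lam ≠ 0)
    (hsym : ∀ z : ℂ, eval (lam * z) p = lam ^ d * eval z p) :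
    ∀ z : ℂ, eval z (derivative p) ≠ 0 →
      cheb p (lam * z) = lam * cheb p z := by
  intro z hz
  have hcomp : C 1 * p.comp (C lam * X) = C (lam ^ d) * p := by
    apply Polynomial.funext
    intro w
    simpa using hsym w
  have hcomp' := mul_derivative_comp_C_mul_X hcomp
  have h₁ : lam * eval (lam * z) (derivative p) = lam ^ d * eval z (derivative p) := by
    simpa using congrArg (eval z) hcomp'
  have h₂ : lam * lam * eval (lam * z) (derivative (derivative p)) =
      lam ^ d * eval z (derivative (derivative p)) := by
    simpa using congrArg (eval z) (mul_derivative_comp_C_mul_X hcomp')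
  have e₁ : eval (lam * z) (derivative p) = lam ^ d * eval z (derivative p) / lam := by
    rw [← h₁]
    field_simp
  have e₂ : eval (lam * z) (derivative (derivative p)) =
      lam ^ d * eval z (derivative (derivative p)) / (lam * lam) := by
    rw [← h₂]
    field_simp
  rw [cheb, cheb, hsym, e₁, e₂]
  field_simp
end

section
/- Let p be a complex polynomial and let z ∈ ℂ be such that p'(z) ≠ 0 and p''(z) ≠ 0. Then the derivative of the Chebyshev's method of p at z satisfies C_p'(z) = (L_p(z)²/2)·(3 − L_{p'}(z)), where L_{p'}(z) = p'(z)·p'''(z)/p''(z)². -/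
open Polynomial

/-- The derivative of Chebyshev's method:
`C_p'(z) = (L_p(z)²/2) (3 − L_{p'}(z))` whenever `p'(z) ≠ 0` and `p''(z) ≠ 0`,
where `L_p(z) = p(z) p''(z)/p'(z)²` and `L_{p'}(z) = p'(z) p'''(z)/p''(z)²`. -/
theorem chebyshev_deriv (p : Polynomial ℂ) (z : ℂ)
    (h₁ : eval z (derivative p) ≠ 0)
    (h₂ : eval z (derivative (derivative p)) ≠ 0) :
    HasDerivAt (cheb p)
      (((eval z p * eval z (derivative (derivative p))
          / (eval z (derivative p)) ^ 2) ^ 2 / 2)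
        * (3 - eval z (derivative p) * eval z (derivative (derivative (derivative p)))
            / (eval z (derivative (derivative p))) ^ 2)) z := by
  have hp := p.hasDerivAt z
  have hp' := (derivative p).hasDerivAt z
  have hp'' := (derivative (derivative p)).hasDerivAt z
  have h := (hasDerivAt_id z).sub
    (((((hp.mul hp'').div (hp'.pow 2) (pow_ne_zero 2 h₁)).div_const 2).const_add 1).mul
      (hp.div hp' h₁))
  refine h.congr_deriv ?_
  simp only [Pi.mul_apply, Pi.div_apply, Pi.pow_apply]
  field_simp
  ring
end

section
/- Let b ∈ ℝ and let f : ℝ → ℝ be differentiable on [b, ∞) with f'(x) > 0 for every x > b, f(x) < x for every x > b, and f(b) = b. Then for every x ≥ b, the sequence of iterates f^n(x) converges to b as n → ∞. -/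
/-- If a continuous map sends `[b, ∞)` to itself and satisfies `f x < x` for `x > b`,
then its iterates starting in `[b, ∞)` converge to `b`. -/
theorem tendsto_iterate_of_mapsTo_Ici {f : ℝ → ℝ} {b : ℝ}
    (hcont : ContinuousOn f (Set.Ici b)) (hmaps : Set.MapsTo f (Set.Ici b) (Set.Ici b))
    (hlt : ∀ x, b < x → f x < x) {x : ℝ} (hx : b ≤ x) :
    Filter.Tendsto (fun n => f^[n] x) Filter.atTop (nhds b) := by
  have hmem : ∀ n, b ≤ f^[n] x := fun n => hmaps.iterate n hx
  have hfb : f b = b := by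
    refine le_antisymm ?_ (hmaps Set.self_mem_Ici)
    have hev : ∀ᶠ y in nhdsWithin b (Set.Ioi b), f y ≤ y :=
      eventually_mem_nhdsWithin.mono fun y hy => (hlt y hy).le
    exact le_of_tendsto_of_tendsto
      ((hcont b Set.self_mem_Ici).mono_left (nhdsWithin_mono b Set.Ioi_subset_Ici_self))
      (Filter.tendsto_id.mono_left nhdsWithin_le_nhds) hev
  have hle : ∀ y, b ≤ y → f y ≤ y := fun y hy =>
    hy.eq_or_lt.elim (fun h => h ▸ hfb.le) fun h => (hlt y h).le
  have hanti : Antitone fun n => f^[n] x := antitone_nat_of_succ_le fun n => by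
    rw [Function.iterate_succ_apply']
    exact hle _ (hmem n)
  have hlim := tendsto_atTop_ciInf hanti ⟨b, Set.forall_mem_range.2 hmem⟩
  set l := ⨅ n, f^[n] x
  have hbl : b ≤ l := ge_of_tendsto' hlim hmem
  have hflim : Filter.Tendsto (fun n => f^[n + 1] x) Filter.atTop (nhds (f l)) := by
    simp only [Function.iterate_succ_apply']
    exact (hcont l hbl).tendsto.comp
      (tendsto_nhdsWithin_iff.2 ⟨hlim, Filter.Eventually.of_forall hmem⟩)
  have hfl : f l = l :=
    tendsto_nhds_unique hflim (hlim.comp (Filter.tendsto_add_atTop_nat 1))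
  rcases hbl.eq_or_lt with h | h
  · rwa [h]
  · exact absurd hfl (hlt l h).ne

/-- If `f` is differentiable on `[b, ∞)` with positive derivative and `f(x) < x`
for all `x > b`, and `f(b) = b`, then the iterates of `f` starting at any
`x ≥ b` converge to `b`. -/
theorem iterates_tendsto_of_increasing_right (b : ℝ) (f : ℝ → ℝ)
    (hdiff : DifferentiableOn ℝ f (Set.Ici b))
    (hderiv : ∀ x, b < x → 0 < derivWithin f (Set.Ici b) x)
    (hlt : ∀ x, b < x → f x < x)
    (hfix : f b = b) :
    ∀ x, b ≤ x → Filter.Tendsto (fun n => f^[n] x) Filter.atTop (nhds b) := by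
  have hmono : StrictMonoOn f (Set.Ici b) := by
    refine strictMonoOn_of_deriv_pos (convex_Ici b) hdiff.continuousOn fun y hy => ?_
    rw [interior_Ici] at hy
    rw [← derivWithin_of_mem_nhds (Ici_mem_nhds hy)]
    exact hderiv y hy
  have hmaps : Set.MapsTo f (Set.Ici b) (Set.Ici b) := fun y hy =>
    hfix.ge.trans (hmono.monotoneOn Set.self_mem_Ici hy hy)
  exact fun x hx => tendsto_iterate_of_mapsTo_Ici hdiff.continuousOn hmaps hlt hx
end

section
/- Let k, m ≥ 1 be integers and let p(z) = (z − 1)^k (z + 1)^m. Then for every z ∈ ℂ with z ≠ 1, z ≠ −1 and (k + m)z + (k − m) ≠ 0, the Chebyshev's method of p satisfies C_p(z) = z − (z − 1)(z + 1) f(z) / (2·((k + m)z + (k − m))³), where f(z) = (k + m)(3k + 3m − 1)z² + 2(k − m)(3k + 3m − 1)z + 3(k − m)² − (k + m). -/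
open Polynomial

/-- The logarithmic derivative of `(X - 1)^k (X + 1)^m`, with denominators cleared. -/
theorem mul_derivative_two_roots (k m : ℕ) (hk : 1 ≤ k) (hm : 1 ≤ m) :
    ((X - 1) * (X + 1) : ℂ[X]) * derivative ((X - 1) ^ k * (X + 1) ^ m)
      = (C ((k : ℂ) + m) * X + C ((k : ℂ) - m)) * ((X - 1) ^ k * (X + 1) ^ m) := by
  obtain ⟨k, rfl⟩ := Nat.exists_eq_add_of_le' hk
  obtain ⟨m, rfl⟩ := Nat.exists_eq_add_of_le' hm
  simp [derivative_mul, derivative_pow]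
  ring

/-- Explicit formula for Chebyshev's method applied to `p(z) = (z-1)^k (z+1)^m`. -/
theorem chebyshev_formula_two_roots (k m : ℕ) (hk : 1 ≤ k) (hm : 1 ≤ m)
    (p : Polynomial ℂ) (hp : p = (X - 1) ^ k * (X + 1) ^ m) :
    ∀ z : ℂ, z ≠ 1 → z ≠ -1 → ((k : ℂ) + m) * z + ((k : ℂ) - m) ≠ 0 →
      cheb p z = z - (z - 1) * (z + 1)
          * (((k : ℂ) + m) * (3 * k + 3 * m - 1) * z ^ 2
              + 2 * ((k : ℂ) - m) * (3 * k + 3 * m - 1) * z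
              + 3 * ((k : ℂ) - m) ^ 2 - ((k : ℂ) + m))
          / (2 * (((k : ℂ) + m) * z + ((k : ℂ) - m)) ^ 3) := by
  intro z hz1 hz2 hg
  have hpz : eval z p ≠ 0 := by
    simp [hp, sub_eq_zero, add_eq_zero_iff_eq_neg, hz1, hz2]
  have hq : (z - 1) * (z + 1) ≠ 0 :=
    mul_ne_zero (sub_ne_zero.mpr hz1) (by rwa [Ne, add_eq_zero_iff_eq_neg])
  have hlog := mul_derivative_two_roots k m hk hm
  rw [← hp] at hlog
  have h1 := congrArg (eval z) hlog
  have h2 := congrArg (fun q => eval z (derivative q)) hlog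
  simp only [derivative_mul, derivative_add, derivative_sub, derivative_X, derivative_one,
    derivative_C, eval_mul, eval_add, eval_sub, eval_X, eval_one, eval_C, eval_zero] at h1 h2
  unfold cheb
  generalize eval z p = a at *
  generalize eval z (derivative p) = b at *
  generalize eval z (derivative (derivative p)) = c at *
  have hb : b = (((k : ℂ) + m) * z + (k - m)) * a / ((z - 1) * (z + 1)) := by
    rw [eq_div_iff hq, ← h1]
    ring
  have hc : c = (((k : ℂ) + m) * a + (((k : ℂ) + m) * z + (k - m)) * b - 2 * z * b)
      / ((z - 1) * (z + 1)) := by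
    rw [eq_div_iff hq]
    linear_combination h2
  rw [hb] at hc
  generalize hgdef : ((k : ℂ) + m) * z + (k - m) = g at *
  have hzm : z - 1 ≠ 0 := left_ne_zero_of_mul hq
  have hzp : z + 1 ≠ 0 := right_ne_zero_of_mul hq
  have hD : (k : ℂ) - m = g - ((k : ℂ) + m) * z := by rw [← hgdef]; ring
  rw [hb, hc, hD]
  field_simp
  ring
end

section
/- Let k, m ≥ 1 be integers, let p(z) = (z − 1)^k (z + 1)^m, and let z₀ ∈ ℂ satisfy (k + m)(3k + 3m − 1)z₀² + 2(k − m)(3k + 3m − 1)z₀ + 3(k − m)² − (k + m) = 0. Then (k + m)z₀ + (k − m) ≠ 0, z₀ is a fixed point of the Chebyshev's method of p (i.e. C_p(z₀) = z₀), and its multiplier C_p'(z₀) = 1 − (3k + 3m − 1)(z₀ − 1)(z₀ + 1)/((k + m)z₀ + (k − m))² is a real number strictly greater than 1; in particular every extraneous fixed point of C_p is repelling. -/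
open Polynomial

/-- The logarithmic derivative of `(z - 1) ^ k * (z + 1) ^ m`, with denominators cleared. -/
lemma derivative_two_roots (k m : ℕ) (p : Polynomial ℂ) (hp : p = (X - 1) ^ k * (X + 1) ^ m) :
    derivative p * (X ^ 2 - 1) = p * (((k : ℂ[X]) + (m : ℂ[X])) * X + ((k : ℂ[X]) - (m : ℂ[X]))) := by
  subst hp
  have h₁ : derivative ((X - 1 : ℂ[X]) ^ k) * (X - 1) = (k : ℂ[X]) * (X - 1) ^ k := by
    cases k with
    | zero => simp
    | succ a => rw [derivative_pow]; simp [pow_succ, mul_assoc]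
  have h₂ : derivative ((X + 1 : ℂ[X]) ^ m) * (X + 1) = (m : ℂ[X]) * (X + 1) ^ m := by
    cases m with
    | zero => simp
    | succ b => rw [derivative_pow]; simp [pow_succ, mul_assoc]
  rw [derivative_mul]
  linear_combination (X + 1) ^ m * (X + 1) * h₁ + (X - 1) ^ k * (X - 1) * h₂

/-- Chebyshev's method of `(z - 1) ^ k * (z + 1) ^ m` in lowest terms, away from the roots. -/
lemma cheb_two_roots (k m : ℕ) (p : Polynomial ℂ) (hp : p = (X - 1) ^ k * (X + 1) ^ m)
    {z : ℂ} (hz : z ^ 2 - 1 ≠ 0) :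
    cheb p z = z - (((k : ℂ) + m) * (3 * k + 3 * m - 1) * z ^ 2
        + 2 * ((k : ℂ) - m) * (3 * k + 3 * m - 1) * z
        + 3 * ((k : ℂ) - m) ^ 2 - ((k : ℂ) + m)) * (z ^ 2 - 1)
        / (2 * (((k : ℂ) + m) * z + ((k : ℂ) - m)) ^ 3) := by
  have h := derivative_two_roots k m p hp
  have h' := congrArg (fun f => eval z (derivative f)) h
  replace h := congrArg (eval z) h
  simp only [eval_mul, eval_sub, eval_add, eval_pow, eval_X, eval_one, eval_natCast,
    derivative_mul, derivative_sub, derivative_add, derivative_X_pow, derivative_X,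
    derivative_one, derivative_natCast, eval_zero, eval_C] at h h'
  have hp0 : eval z p ≠ 0 := by
    have h1 : z - 1 ≠ 0 := fun h0 => hz (by linear_combination (z + 1) * h0)
    have h2 : z + 1 ≠ 0 := fun h0 => hz (by linear_combination (z - 1) * h0)
    simp [hp, h1, h2]
  set P := eval z p with hP
  set q : ℂ := (k + m) * z + (k - m) with hq
  have hP' : eval z (derivative p) = P * q / (z ^ 2 - 1) := by
    rw [eq_div_iff hz, h]
  have hP'' : eval z (derivative (derivative p))
      = P * (q ^ 2 - 2 * z * q + (k + m) * (z ^ 2 - 1)) / (z ^ 2 - 1) ^ 2 := by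
    rw [eq_div_iff (pow_ne_zero 2 hz)]
    push_cast at h'
    linear_combination (z ^ 2 - 1) * h' + (q - 2 * z) * h
  unfold cheb
  rw [hP', hP'', ← hP]
  by_cases hq0 : q = 0
  · simp [hq0]
  · have hF : ((k : ℂ) + m) * (3 * k + 3 * m - 1) * z ^ 2
        + 2 * ((k : ℂ) - m) * (3 * k + 3 * m - 1) * z + 3 * ((k : ℂ) - m) ^ 2 - ((k : ℂ) + m)
        = 3 * q ^ 2 - 2 * z * q + (k + m) * (z ^ 2 - 1) := by
      rw [hq]; ring
    rw [hF]
    clear_value q P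
    field_simp
    ring

/-- Every extraneous fixed point of Chebyshev's method of `p(z) = (z-1)^k (z+1)^m`
is repelling: any solution `z₀` of
`(k+m)(3k+3m-1)z₀² + 2(k-m)(3k+3m-1)z₀ + 3(k-m)² - (k+m) = 0` satisfies
`(k+m)z₀ + (k-m) ≠ 0`, is a fixed point of `C_p`, and its multiplier
`C_p'(z₀) = 1 - (3k+3m-1)(z₀-1)(z₀+1)/((k+m)z₀+(k-m))²` is real and `> 1`. -/
theorem extraneous_fixed_points_repelling_two_roots (k m : ℕ)
    (hk : 1 ≤ k) (hm : 1 ≤ m)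
    (p : Polynomial ℂ) (hp : p = (X - 1) ^ k * (X + 1) ^ m)
    (z₀ : ℂ)
    (hz₀ : ((k : ℂ) + m) * (3 * k + 3 * m - 1) * z₀ ^ 2
        + 2 * ((k : ℂ) - m) * (3 * k + 3 * m - 1) * z₀
        + 3 * ((k : ℂ) - m) ^ 2 - ((k : ℂ) + m) = 0) :
    ((k : ℂ) + m) * z₀ + ((k : ℂ) - m) ≠ 0
      ∧ cheb p z₀ = z₀
      ∧ HasDerivAt (cheb p)
          (1 - (3 * (k : ℂ) + 3 * m - 1) * (z₀ - 1) * (z₀ + 1)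
            / (((k : ℂ) + m) * z₀ + ((k : ℂ) - m)) ^ 2) z₀
      ∧ ∃ r : ℝ, (1 - (3 * (k : ℂ) + 3 * m - 1) * (z₀ - 1) * (z₀ + 1)
            / (((k : ℂ) + m) * z₀ + ((k : ℂ) - m)) ^ 2) = (r : ℂ) ∧ 1 < r := by
  have hk' : (1 : ℝ) ≤ k := by exact_mod_cast hk
  have hm' : (1 : ℝ) ≤ m := by exact_mod_cast hm
  have hs : (0 : ℝ) < k + m := by linarith
  have hc : (0 : ℝ) < 3 * k + 3 * m - 1 := by linarith
  have hsC : (k : ℂ) + m ≠ 0 := by exact_mod_cast hs.ne'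
  have hcC : (3 : ℂ) * k + 3 * m - 1 ≠ 0 := by exact_mod_cast hc.ne'
  have hsq : (((k : ℂ) + m) * z₀ + (k - m)) ^ 2
      = ((√(4 * k * m / (3 * k + 3 * m - 1)) : ℝ) : ℂ) ^ 2 := by
    rw [← Complex.ofReal_pow, Real.sq_sqrt (by positivity)]
    push_cast
    rw [eq_div_iff hcC]
    linear_combination ((k : ℂ) + m) * hz₀
  obtain ⟨x, rfl⟩ : ∃ x : ℝ, z₀ = x := by
    rcases sq_eq_sq_iff_eq_or_eq_neg.mp hsq with h | h
    · refine ⟨(√(4 * k * m / (3 * k + 3 * m - 1)) - (k - m)) / (k + m), ?_⟩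
      push_cast
      rw [eq_div_iff hsC]
      linear_combination h
    · refine ⟨(-√(4 * k * m / (3 * k + 3 * m - 1)) - (k - m)) / (k + m), ?_⟩
      push_cast
      rw [eq_div_iff hsC]
      linear_combination h
  have hx : (3 * (k : ℝ) + 3 * m - 1) * ((k + m) * x + (k - m)) ^ 2 = 4 * k * m := by
    have : (3 * (k : ℂ) + 3 * m - 1) * ((k + m) * x + (k - m)) ^ 2 = 4 * k * m := by
      linear_combination ((k : ℂ) + m) * hz₀
    exact_mod_cast this
  have hq : ((k : ℝ) + m) * x + (k - m) ≠ 0 := by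
    intro h
    rw [h] at hx
    nlinarith
  have hx1 : x < 1 := by
    by_contra! h
    have h1 : 2 * (k : ℝ) ≤ (k + m) * x + (k - m) := by nlinarith
    have h2 : (2 * (k : ℝ)) ^ 2 ≤ ((k + m) * x + (k - m)) ^ 2 := by gcongr
    have h3 := mul_le_mul_of_nonneg_left h2 hc.le
    nlinarith [mul_pos (by linarith : (0 : ℝ) < k) (by nlinarith :
      (0 : ℝ) < k * (3 * k + 3 * m - 1) - m)]
  have hx2 : -1 < x := by
    by_contra! h
    have h1 : 2 * (m : ℝ) ≤ -((k + m) * x + (k - m)) := by nlinarith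
    have h2 : (2 * (m : ℝ)) ^ 2 ≤ (-((k + m) * x + (k - m))) ^ 2 := by gcongr
    have h3 := mul_le_mul_of_nonneg_left h2 hc.le
    nlinarith [mul_pos (by linarith : (0 : ℝ) < m) (by nlinarith :
      (0 : ℝ) < m * (3 * k + 3 * m - 1) - k)]
  have hw : x ^ 2 - 1 < 0 := by nlinarith
  have hwC : (x : ℂ) ^ 2 - 1 ≠ 0 := by exact_mod_cast hw.ne
  have hqC : ((k : ℂ) + m) * x + (k - m) ≠ 0 := by exact_mod_cast hq
  refine ⟨hqC, ?_, ?_, 1 - (3 * (k : ℝ) + 3 * m - 1) * (x - 1) * (x + 1)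
    / ((k + m) * x + (k - m)) ^ 2, by push_cast; rfl, ?_⟩
  · rw [cheb_two_roots k m p hp hwC, hz₀]
    simp
  · have hev : ∀ᶠ z : ℂ in nhds (x : ℂ), z ^ 2 - 1 ≠ 0 :=
      ContinuousAt.eventually_ne (by fun_prop) hwC
    refine HasDerivAt.congr_of_eventuallyEq ?_ (hev.mono fun z hz => cheb_two_roots k m p hp hz)
    have hid := hasDerivAt_id' (x : ℂ)
    have hsqr := hid.pow 2
    have hF := ((((hsqr.const_mul (((k : ℂ) + m) * (3 * k + 3 * m - 1))).add
      (hid.const_mul (2 * ((k : ℂ) - m) * (3 * k + 3 * m - 1)))).add_const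
      (3 * ((k : ℂ) - m) ^ 2)).sub_const ((k : ℂ) + m))
    have hD := (((hid.const_mul ((k : ℂ) + m)).add_const ((k : ℂ) - m)).pow 3).const_mul 2
    have hC := hid.sub ((hF.mul (hsqr.sub_const 1)).div hD
      (mul_ne_zero two_ne_zero (pow_ne_zero 3 hqC)))
    refine hC.congr_deriv ?_
    simp only [Pi.add_apply, Pi.mul_apply, Pi.pow_apply]
    rw [hz₀]
    field_simp
    ring
  · have hneg : (3 * (k : ℝ) + 3 * m - 1) * (x - 1) * (x + 1)
        / ((k + m) * x + (k - m)) ^ 2 < 0 :=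
      div_neg_of_neg_of_pos (by nlinarith) (by positivity)
    linarith
end

section
/- Let k ≥ 1 be an integer and define F : ℝ → ℝ by F(x) = ((2k − 1)(4k − 1)x⁴ + 6k·x² − 1) / (8k²·x³). Then for every real x ≤ −1, the sequence of iterates F^n(x) converges to −1 as n → ∞. (F is the restriction to the real line of the Chebyshev's method applied to p(z) = (z − 1)^k (z + 1)^k, whose immediate basin of −1 therefore contains (−∞, −1].) -/
/-- One step of Chebyshev's method for `(z - 1)^κ (z + 1)^κ` preserves `[1, ∞)` (up to the sign
`x = -y`) and contracts the distance to `1` by the factor `(2κ - 1)(4κ - 1) / (8κ²)`. -/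
lemma chebyshev_two_roots_contracts {κ x : ℝ} (hκ : 1 ≤ κ) (hx : x ≤ -1) :
    ((2 * κ - 1) * (4 * κ - 1) * x ^ 4 + 6 * κ * x ^ 2 - 1) / (8 * κ ^ 2 * x ^ 3) ≤ -1 ∧
      -1 - ((2 * κ - 1) * (4 * κ - 1) * x ^ 4 + 6 * κ * x ^ 2 - 1) / (8 * κ ^ 2 * x ^ 3) ≤
        (2 * κ - 1) * (4 * κ - 1) / (8 * κ ^ 2) * (-1 - x) := by
  obtain ⟨y, rfl⟩ : ∃ y, x = -y := ⟨-x, by ring⟩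
  have hy : 1 ≤ y := by linarith
  have hy0 : 0 < y := by linarith
  have hκ0 : 0 < κ := by linarith
  have hd : 0 < 8 * κ ^ 2 * y ^ 3 := by positivity
  have hlow : 0 ≤ (y - 1) ^ 2 * (3 * y + 1) + (κ - 1) * (y ^ 2 * ((8 * κ + 2) * y - 6)) := by
    have h1 : 0 ≤ (8 * κ + 2) * y - 6 := by nlinarith
    have h2 : 0 ≤ κ - 1 := by linarith
    positivity
  have hupp : 0 ≤ (6 * κ - 1) * y ^ 2 - y - 1 := by nlinarith [sq_nonneg (y - 1)]
  have hfix : -1 - ((2 * κ - 1) * (4 * κ - 1) * (-y) ^ 4 + 6 * κ * (-y) ^ 2 - 1) /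
      (8 * κ ^ 2 * (-y) ^ 3) = (y - 1) * ((y - 1) ^ 2 * (3 * y + 1) +
        (κ - 1) * (y ^ 2 * ((8 * κ + 2) * y - 6))) / (8 * κ ^ 2 * y ^ 3) := by
    rw [show (-y) ^ 3 = -y ^ 3 by ring]
    field_simp
    ring
  have hgap : (2 * κ - 1) * (4 * κ - 1) / (8 * κ ^ 2) * (-1 - -y) -
      (y - 1) * ((y - 1) ^ 2 * (3 * y + 1) +
        (κ - 1) * (y ^ 2 * ((8 * κ + 2) * y - 6))) / (8 * κ ^ 2 * y ^ 3) =
      (y - 1) * ((6 * κ - 1) * y ^ 2 - y - 1) / (8 * κ ^ 2 * y ^ 3) := by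
    field_simp
    ring
  have hy1 : 0 ≤ y - 1 := by linarith
  have hfix_nonneg := div_nonneg (mul_nonneg hy1 hlow) hd.le
  have hgap_nonneg := div_nonneg (mul_nonneg hy1 hupp) hd.le
  constructor <;> linarith


/-- For `k ≥ 1`, the real restriction
`F(x) = ((2k-1)(4k-1)x⁴ + 6k x² - 1)/(8k² x³)` of Chebyshev's method applied to
`p(z) = (z-1)^k (z+1)^k` satisfies: the iterates of every `x ≤ -1` converge
to `-1`. -/
theorem iterates_tendsto_neg_one_two_roots (k : ℕ) (hk : 1 ≤ k)
    (F : ℝ → ℝ)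
    (hF : ∀ x : ℝ, F x = ((2 * (k : ℝ) - 1) * (4 * (k : ℝ) - 1) * x ^ 4
        + 6 * (k : ℝ) * x ^ 2 - 1) / (8 * (k : ℝ) ^ 2 * x ^ 3)) :
    ∀ x : ℝ, x ≤ -1 →
      Filter.Tendsto (fun n => F^[n] x) Filter.atTop (nhds (-1)) := by
  intro x hx
  have hκ : (1 : ℝ) ≤ k := by exact_mod_cast hk
  set c : ℝ := (2 * (k : ℝ) - 1) * (4 * (k : ℝ) - 1) / (8 * (k : ℝ) ^ 2) with hc
  have hc0 : 0 ≤ c :=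
    div_nonneg (mul_nonneg (by linarith) (by linarith)) (by positivity)
  have hc1 : c < 1 := by
    rw [hc, div_lt_one (by positivity)]
    nlinarith
  have hiter : ∀ n, F^[n] x ≤ -1 ∧ -1 - F^[n] x ≤ c ^ n * (-1 - x) := by
    intro n
    induction n with
    | zero => simpa using hx
    | succ n ih =>
      rw [Function.iterate_succ_apply', hF]
      obtain ⟨h1, h2⟩ := chebyshev_two_roots_contracts hκ ih.1
      refine ⟨h1, h2.trans ?_⟩
      rw [pow_succ' c, mul_assoc c]
      exact mul_le_mul_of_nonneg_left ih.2 hc0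
  have hlim : Filter.Tendsto (fun n => -1 - c ^ n * (-1 - x)) Filter.atTop (nhds (-1)) := by
    simpa using
      ((tendsto_pow_atTop_nhds_zero_of_lt_one hc0 hc1).mul_const (-1 - x)).const_sub (-1)
  exact tendsto_of_tendsto_of_tendsto_of_le_of_le hlim tendsto_const_nhds
    (fun n => by linarith [(hiter n).2]) (fun n => (hiter n).1)
end

section
/- Let n ≥ 3 be an integer and define F : ℝ → ℝ by F(x) = ((2n² − 3n + 1)x^{2n} + 2(2n − 1)x^n − (n − 1)) / (2n²·x^{2n−1}). Then for every real x ≥ 1, the sequence of iterates F^n(x) converges to 1 as n → ∞. (F is the restriction to the real line of the Chebyshev's method applied to the unicritical polynomial p(z) = z^n − 1, whose immediate basin of 1 therefore contains [1, ∞).) -/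
/-- The real restriction of Chebyshev's method applied to `z ^ n - 1`. -/
noncomputable def chebyshevUnicritical (n : ℕ) (x : ℝ) : ℝ :=
  ((2 * (n : ℝ) ^ 2 - 3 * (n : ℝ) + 1) * x ^ (2 * n)
    + 2 * (2 * (n : ℝ) - 1) * x ^ n - ((n : ℝ) - 1)) / (2 * (n : ℝ) ^ 2 * x ^ (2 * n - 1))

namespace chebyshevUnicritical

theorem apply_one {n : ℕ} (hn : 1 ≤ n) : chebyshevUnicritical n 1 = 1 := by
  have h : (n : ℝ) ≠ 0 := by positivity
  simp only [chebyshevUnicritical, one_pow]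
  field_simp
  ring

theorem hasDerivAt {n : ℕ} (hn : 1 ≤ n) {x : ℝ} (hx : x ≠ 0) :
    HasDerivAt (chebyshevUnicritical n)
      ((2 * n - 1) * (n - 1) / (2 * n ^ 2) * ((x ^ n - 1) / x ^ n) ^ 2) x := by
  obtain ⟨m, rfl⟩ := Nat.exists_eq_add_of_le' hn
  have hm : ((m : ℝ) + 1) ≠ 0 := by positivity
  have hD : 2 * ((m + 1 : ℕ) : ℝ) ^ 2 * x ^ (2 * (m + 1) - 1) ≠ 0 := by
    push_cast
    positivity
  have hnum := ((((hasDerivAt_pow (2 * (m + 1)) x).const_mul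
    (2 * ((m + 1 : ℕ) : ℝ) ^ 2 - 3 * ((m + 1 : ℕ) : ℝ) + 1)).add
    ((hasDerivAt_pow (m + 1) x).const_mul (2 * (2 * ((m + 1 : ℕ) : ℝ) - 1)))).sub_const
    (((m + 1 : ℕ) : ℝ) - 1))
  have hden := (hasDerivAt_pow (2 * (m + 1) - 1) x).const_mul (2 * ((m + 1 : ℕ) : ℝ) ^ 2)
  refine (hnum.div hden hD).congr_deriv ?_
  have e₁ : 2 * (m + 1) - 1 = 2 * m + 1 := by lia
  simp only [Pi.add_apply, e₁, Nat.add_sub_cancel]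
  push_cast
  field_simp
  ring

theorem lt_self {n : ℕ} (hn : 1 ≤ n) {x : ℝ} (hx : 1 < x) : chebyshevUnicritical n x < x := by
  have hn' : (1 : ℝ) ≤ n := by exact_mod_cast hn
  have hx0 : 0 < x := by linarith
  have ht : 1 < x ^ n := one_lt_pow₀ hx (by lia)
  have e : x * x ^ (2 * n - 1) = (x ^ n) ^ 2 := by
    rw [← pow_succ', ← pow_mul]
    congr 1
    lia
  rw [chebyshevUnicritical, div_lt_iff₀ (by positivity), mul_left_comm, e, mul_comm 2 n, pow_mul]
  nlinarith [mul_pos (sub_pos.2 ht) (show 0 < (3 * (n : ℝ) - 1) * x ^ n - (n - 1) by nlinarith)]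

theorem monotoneOn {n : ℕ} (hn : 1 ≤ n) : MonotoneOn (chebyshevUnicritical n) (Set.Ici 1) := by
  have hn' : (1 : ℝ) ≤ n := by exact_mod_cast hn
  have hd : ∀ x ∈ Set.Ici (1 : ℝ), HasDerivAt (chebyshevUnicritical n) _ x := fun x hx =>
    hasDerivAt hn (zero_lt_one.trans_le hx).ne'
  refine monotoneOn_of_deriv_nonneg (convex_Ici 1)
    (fun x hx => (hd x hx).continuousAt.continuousWithinAt)
    (fun x hx => (hd x (interior_subset hx)).differentiableAt.differentiableWithinAt)
    fun x hx => ?_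
  rw [(hd x (interior_subset hx)).deriv]
  have h₁ : 0 ≤ 2 * (n : ℝ) - 1 := by linarith
  have h₂ : 0 ≤ (n : ℝ) - 1 := by linarith
  positivity

theorem one_le {n : ℕ} (hn : 1 ≤ n) {x : ℝ} (hx : 1 ≤ x) : 1 ≤ chebyshevUnicritical n x := by
  simpa only [apply_one hn] using monotoneOn hn Set.self_mem_Ici hx hx

theorem tendsto_iterate {n : ℕ} (hn : 1 ≤ n) {x : ℝ} (hx : 1 ≤ x) :
    Filter.Tendsto (fun j => (chebyshevUnicritical n)^[j] x) Filter.atTop (nhds 1) := by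
  have hge : ∀ j, 1 ≤ (chebyshevUnicritical n)^[j] x := fun j =>
    (show Set.MapsTo (chebyshevUnicritical n) (Set.Ici 1) (Set.Ici 1) from
      fun _ hy => one_le hn hy).iterate j (Set.mem_Ici.2 hx)
  have hanti : Antitone fun j => (chebyshevUnicritical n)^[j] x := by
    refine antitone_nat_of_succ_le fun j => ?_
    rw [Function.iterate_succ_apply']
    rcases (hge j).eq_or_lt with h | h
    · rw [← h, apply_one hn]
    · exact (lt_self hn h).le
  have hlim := tendsto_atTop_ciInf hanti ⟨1, by rintro _ ⟨j, rfl⟩; exact hge j⟩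
  set L := ⨅ j, (chebyshevUnicritical n)^[j] x
  have hL : 1 ≤ L := ge_of_tendsto' hlim hge
  have hfix := isFixedPt_of_tendsto_iterate hlim
    (hasDerivAt hn (zero_lt_one.trans_le hL).ne').continuousAt
  rcases hL.eq_or_lt with h | h
  · rwa [← h] at hlim
  · exact absurd hfix (lt_self hn h).ne

end chebyshevUnicritical

/-- For `n ≥ 3`, the real restriction
`F(x) = ((2n²-3n+1)x^(2n) + 2(2n-1)x^n - (n-1))/(2n² x^(2n-1))` of Chebyshev's
method applied to `p(z) = z^n - 1` satisfies: the iterates of every `x ≥ 1`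
converge to `1`. -/
theorem iterates_tendsto_one_unicritical (n : ℕ) (hn : 3 ≤ n)
    (F : ℝ → ℝ)
    (hF : ∀ x : ℝ, F x = ((2 * (n : ℝ) ^ 2 - 3 * (n : ℝ) + 1) * x ^ (2 * n)
        + 2 * (2 * (n : ℝ) - 1) * x ^ n - ((n : ℝ) - 1))
        / (2 * (n : ℝ) ^ 2 * x ^ (2 * n - 1))) :
    ∀ x : ℝ, 1 ≤ x →
      Filter.Tendsto (fun j => F^[j] x) Filter.atTop (nhds 1) := by
  intro x hx
  obtain rfl : F = chebyshevUnicritical n := funext hF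
  exact chebyshevUnicritical.tendsto_iterate (by lia) hx
end

section
/- Let n ≥ 2 be an integer, let p(z) = z^n − 1, and let z ∈ ℂ satisfy z^n = (n − 1)/(3n − 1). Then z ≠ 0, z is a fixed point of the Chebyshev's method of p (i.e. C_p(z) = z), and its multiplier satisfies C_p'(z) = 2(2n − 1)/(n − 1), which is a real number strictly greater than 1; in particular all extraneous fixed points of C_p are repelling. -/
open Polynomial

/-- The derivative of Chebyshev's method, `C_p' = p² (3 p''² - p' p''') / (2 p'⁴)`. -/
theorem hasDerivAt_cheb (p : Polynomial ℂ) (z : ℂ) (h : eval z (derivative p) ≠ 0) :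
    HasDerivAt (cheb p)
      (eval z p ^ 2 * (3 * eval z (derivative (derivative p)) ^ 2
          - eval z (derivative p) * eval z (derivative (derivative (derivative p))))
        / (2 * eval z (derivative p) ^ 4)) z := by
  have h0 := p.hasDerivAt z
  have h1 := (derivative p).hasDerivAt z
  have h2 := (derivative (derivative p)).hasDerivAt z
  have hC := (hasDerivAt_id z).sub
    (((((h0.mul h2).div (h1.pow 2) (pow_ne_zero 2 h)).div_const 2).const_add 1).mul (h0.div h1 h))
  refine hC.congr_deriv ?_
  simp only [Pi.mul_apply, Pi.div_apply, Pi.pow_apply]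
  field_simp
  ring

theorem X_mul_derivative_X_pow_sub_one (n : ℕ) :
    X * derivative (X ^ n - 1 : Polynomial ℂ) = C (n : ℂ) * X ^ n := by
  cases n with
  | zero => simp
  | succ k =>
    rw [derivative_sub, derivative_X_pow, derivative_one, Nat.add_sub_cancel]
    ring

theorem X_mul_derivative_derivative_X_pow_sub_one (n : ℕ) :
    X * derivative (derivative (X ^ n - 1 : Polynomial ℂ))
      = C ((n : ℂ) - 1) * derivative (X ^ n - 1) := by
  have h := congrArg derivative (X_mul_derivative_X_pow_sub_one n)
  have h' : derivative (X ^ n - 1 : Polynomial ℂ) = derivative (X ^ n) := by simp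
  rw [derivative_mul, derivative_X, derivative_C_mul, ← h'] at h
  rw [C_sub, C_1]
  linear_combination h

theorem X_mul_derivative_derivative_derivative_X_pow_sub_one (n : ℕ) :
    X * derivative (derivative (derivative (X ^ n - 1 : Polynomial ℂ)))
      = C ((n : ℂ) - 2) * derivative (derivative (X ^ n - 1)) := by
  have h := congrArg derivative (X_mul_derivative_derivative_X_pow_sub_one n)
  rw [derivative_mul, derivative_X, derivative_C_mul] at h
  have h2 : C ((n : ℂ) - 2) = C ((n : ℂ) - 1) - 1 := by
    rw [← C_1, ← C_sub]; ring_nf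
  rw [h2]
  linear_combination h

/-- For `p(z) = z^n - 1` with `n ≥ 2`, any `z` with `z^n = (n-1)/(3n-1)` is a
nonzero fixed point of `C_p` with multiplier `2(2n-1)/(n-1) > 1`; all extraneous
fixed points are repelling. -/
theorem extraneous_fixed_points_repelling_unicritical (n : ℕ) (hn : 2 ≤ n)
    (p : Polynomial ℂ) (hp : p = X ^ n - 1)
    (z : ℂ) (hz : z ^ n = ((n : ℂ) - 1) / (3 * (n : ℂ) - 1)) :
    z ≠ 0
      ∧ cheb p z = z
      ∧ HasDerivAt (cheb p)
          ((2 * (2 * (n : ℝ) - 1) / ((n : ℝ) - 1) : ℝ) : ℂ) z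
      ∧ 1 < 2 * (2 * (n : ℝ) - 1) / ((n : ℝ) - 1) := by
  subst hp
  rw [mul_comm 3] at hz
  have hn0 : (n : ℂ) ≠ 0 := by exact_mod_cast (by omega : n ≠ 0)
  have hn1 : (n : ℂ) - 1 ≠ 0 := sub_ne_zero.2 (by exact_mod_cast (by omega : n ≠ 1))
  have hn3 : (n : ℂ) * 3 - 1 ≠ 0 := sub_ne_zero.2 (by exact_mod_cast (by omega : n * 3 ≠ 1))
  have hz0 : z ≠ 0 := by
    rintro rfl
    rw [zero_pow (by omega)] at hz
    exact div_ne_zero hn1 hn3 hz.symm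
  have h0 : eval z (X ^ n - 1 : Polynomial ℂ) = -2 * n / (n * 3 - 1) := by
    simp only [eval_sub, eval_pow, eval_X, eval_one, hz]
    field_simp
    ring
  have h1 : eval z (derivative (X ^ n - 1 : Polynomial ℂ))
      = n * (n - 1) / ((n * 3 - 1) * z) := by
    have h := congrArg (eval z) (X_mul_derivative_X_pow_sub_one n)
    simp only [eval_mul, eval_X, eval_C, eval_pow, hz] at h
    rw [eq_div_iff (mul_ne_zero hn3 hz0)]
    field_simp at h
    linear_combination h
  have h2 : eval z (derivative (derivative (X ^ n - 1 : Polynomial ℂ)))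
      = n * (n - 1) ^ 2 / ((n * 3 - 1) * z ^ 2) := by
    have h := congrArg (eval z) (X_mul_derivative_derivative_X_pow_sub_one n)
    rw [eval_mul, eval_X, eval_mul, eval_C, h1] at h
    apply mul_left_cancel₀ hz0
    rw [h]
    field_simp
  have h3 : eval z (derivative (derivative (derivative (X ^ n - 1 : Polynomial ℂ))))
      = n * (n - 1) ^ 2 * (n - 2) / ((n * 3 - 1) * z ^ 3) := by
    have h := congrArg (eval z) (X_mul_derivative_derivative_derivative_X_pow_sub_one n)
    rw [eval_mul, eval_X, eval_mul, eval_C, h2] at h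
    apply mul_left_cancel₀ hz0
    rw [h]
    field_simp
  have hp' : eval z (derivative (X ^ n - 1 : Polynomial ℂ)) ≠ 0 := by
    rw [h1]
    exact div_ne_zero (mul_ne_zero hn0 hn1) (mul_ne_zero hn3 hz0)
  refine ⟨hz0, ?_, (hasDerivAt_cheb _ z hp').congr_deriv ?_, ?_⟩
  · rw [cheb, h0, h1, h2]
    field_simp
    ring
  · rw [h0, h1, h2, h3]
    push_cast
    field_simp
    ring
  · have hn2 : (2 : ℝ) ≤ n := by exact_mod_cast hn
    rw [one_lt_div (by linarith)]
    linarith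
end

section
/- Define φ : ℝ → ℝ by φ(y) = y³(15y⁴ + 6y² − 1)/(3y² + 1)³. Then for every y ∈ ℝ, the sequence of iterates φ^n(y) converges to 0 as n → ∞. (Since C_p(iy) = i·φ(y) for p(z) = z(z² − 1), this shows the entire imaginary axis lies in the basin of attraction of the fixed point 0 of the Chebyshev's method of p.) -/
theorem abs_chebyshev_imaginary_axis_cubic_le (y : ℝ) :
    |y ^ 3 * (15 * y ^ 4 + 6 * y ^ 2 - 1) / (3 * y ^ 2 + 1) ^ 3| ≤ 5 / 9 * |y| := by
  have hd : 0 < (3 * y ^ 2 + 1) ^ 3 := by positivity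
  have h : |y ^ 2 * (15 * y ^ 4 + 6 * y ^ 2 - 1)| ≤ 5 / 9 * (3 * y ^ 2 + 1) ^ 3 := by
    have h2 := sq_nonneg y
    have h4 : 0 ≤ y ^ 4 := by positivity
    have h6 : 0 ≤ y ^ 6 := by positivity
    rw [abs_le]
    constructor <;> nlinarith
  rw [abs_div, abs_of_pos hd, div_le_iff₀ hd]
  calc |y ^ 3 * (15 * y ^ 4 + 6 * y ^ 2 - 1)|
      = |y| * |y ^ 2 * (15 * y ^ 4 + 6 * y ^ 2 - 1)| := by rw [← abs_mul]; ring_nf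
    _ ≤ |y| * (5 / 9 * (3 * y ^ 2 + 1) ^ 3) := by gcongr
    _ = 5 / 9 * |y| * (3 * y ^ 2 + 1) ^ 3 := by ring

/-- For `φ(y) = y³(15y⁴ + 6y² - 1)/(3y² + 1)³` (the imaginary-axis restriction
of Chebyshev's method of `p(z) = z(z²-1)`), the iterates of every real `y`
converge to `0`. -/
theorem iterates_tendsto_zero_imaginary_axis_cubic (φ : ℝ → ℝ)
    (hφ : ∀ y : ℝ, φ y = y ^ 3 * (15 * y ^ 4 + 6 * y ^ 2 - 1)
        / (3 * y ^ 2 + 1) ^ 3) :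
    ∀ y : ℝ, Filter.Tendsto (fun n => φ^[n] y) Filter.atTop (nhds 0) := by
  intro y
  have hbound : ∀ n : ℕ, ‖φ^[n] y‖ ≤ (5 / 9 : ℝ) ^ n * |y| := by
    intro n
    induction n with
    | zero => simp
    | succ n ih =>
      rw [Function.iterate_succ_apply', hφ, Real.norm_eq_abs]
      rw [Real.norm_eq_abs] at ih
      refine (abs_chebyshev_imaginary_axis_cubic_le _).trans ?_
      rw [pow_succ]
      linarith
  refine squeeze_zero_norm hbound ?_
  simpa using (tendsto_pow_atTop_nhds_zero_of_lt_one (r := (5 / 9 : ℝ))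
    (by norm_num) (by norm_num)).mul_const |y|
end

section
/- Define F : ℝ → ℝ by F(x) = x³(15x⁴ − 6x² − 1)/(3x² − 1)³. Then for every real x ≤ −1, the sequence of iterates F^n(x) converges to −1 as n → ∞. (F is the restriction to the real line of the Chebyshev's method applied to p(z) = z(z² − 1), whose immediate basin of −1 therefore contains (−∞, −1].) -/
/-- Chebyshev's method for `z(z²-1)` maps `(-∞, -1]` into itself and contracts
the distance to `-1` by a factor `2/3` there. -/
theorem chebyshev_cubic_contracts {x : ℝ} (hx : x ≤ -1) :
    x ^ 3 * (15 * x ^ 4 - 6 * x ^ 2 - 1) / (3 * x ^ 2 - 1) ^ 3 ≤ -1 ∧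
      -1 - x ^ 3 * (15 * x ^ 4 - 6 * x ^ 2 - 1) / (3 * x ^ 2 - 1) ^ 3 ≤ 2 / 3 * (-1 - x) := by
  obtain ⟨t, ht, rfl⟩ : ∃ t : ℝ, 0 ≤ t ∧ x = -1 - t := ⟨-1 - x, by linarith, by ring⟩
  have hpos : 0 < (3 * (-1 - t) ^ 2 - 1) ^ 3 := by
    have : 0 < 3 * (-1 - t) ^ 2 - 1 := by nlinarith
    positivity
  constructor
  · rw [div_le_iff₀ hpos, ← sub_nonneg]
    ring_nf
    positivity
  · rw [sub_le_comm, le_div_iff₀ hpos, ← sub_nonneg]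
    ring_nf
    positivity

/-- For `F(x) = x³(15x⁴ - 6x² - 1)/(3x² - 1)³` (the real restriction of
Chebyshev's method of `p(z) = z(z²-1)`), the iterates of every `x ≤ -1`
converge to `-1`. -/
theorem iterates_tendsto_neg_one_cubic (F : ℝ → ℝ)
    (hF : ∀ x : ℝ, F x = x ^ 3 * (15 * x ^ 4 - 6 * x ^ 2 - 1)
        / (3 * x ^ 2 - 1) ^ 3) :
    ∀ x : ℝ, x ≤ -1 →
      Filter.Tendsto (fun n => F^[n] x) Filter.atTop (nhds (-1)) := by
  intro x hx
  have key : ∀ n, F^[n] x ≤ -1 ∧ -1 - F^[n] x ≤ (2 / 3 : ℝ) ^ n * (-1 - x) := by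
    intro n
    induction n with
    | zero => simpa using hx
    | succ n ih =>
      have h := chebyshev_cubic_contracts ih.1
      rw [← hF] at h
      rw [Function.iterate_succ_apply', pow_succ']
      exact ⟨h.1, by linarith [h.2, ih.2]⟩
  have hlim : Filter.Tendsto (fun n : ℕ => -1 - (2 / 3 : ℝ) ^ n * (-1 - x))
      Filter.atTop (nhds (-1)) := by
    simpa using ((tendsto_pow_atTop_nhds_zero_of_lt_one (r := (2 / 3 : ℝ)) (by norm_num)
      (by norm_num)).mul_const (-1 - x)).const_sub (-1)
  exact tendsto_of_tendsto_of_tendsto_of_le_of_le hlim tendsto_const_nhds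
    (fun n => by linarith [(key n).2]) (fun n => (key n).1)
end

section
/- Let p(z) = z(z² − 1) and let z ∈ ℂ satisfy 12z⁴ − 9z² + 1 = 0. Then 3z² − 1 ≠ 0, z is a fixed point of the Chebyshev's method of p (i.e. C_p(z) = z), and its multiplier satisfies C_p'(z) = 5 + 1/(3z²), which is a real number strictly greater than 1; in particular all extraneous fixed points of C_p are repelling. -/
open Polynomial

theorem eval_cubic (z : ℂ) : eval z (X * (X ^ 2 - 1) : ℂ[X]) = z * (z ^ 2 - 1) := by
  simp

theorem eval_derivative_cubic (z : ℂ) :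
    eval z (derivative (X * (X ^ 2 - 1) : ℂ[X])) = 3 * z ^ 2 - 1 := by
  simp
  ring

theorem eval_derivative_derivative_cubic (z : ℂ) :
    eval z (derivative (derivative (X * (X ^ 2 - 1) : ℂ[X]))) = 6 * z := by
  simp
  ring

theorem cheb_cubic (z : ℂ) :
    cheb (X * (X ^ 2 - 1)) z =
      z - (1 + (z * (z ^ 2 - 1) * (6 * z) / (3 * z ^ 2 - 1) ^ 2) / 2)
        * (z * (z ^ 2 - 1) / (3 * z ^ 2 - 1)) := by
  rw [cheb, eval_cubic, eval_derivative_cubic, eval_derivative_derivative_cubic]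

theorem hasDerivAt_cheb_cubic {z : ℂ} (h : 3 * z ^ 2 - 1 ≠ 0) :
    HasDerivAt (cheb (X * (X ^ 2 - 1)))
      (3 * z ^ 2 * (z ^ 2 - 1) ^ 2 * (15 * z ^ 2 + 1) / (3 * z ^ 2 - 1) ^ 4) z := by
  have hq : HasDerivAt (fun x : ℂ => x ^ 2) (2 * z) z := by
    simpa using hasDerivAt_pow 2 z
  have hp : HasDerivAt (fun x : ℂ => x * (x ^ 2 - 1)) (1 * (z ^ 2 - 1) + z * (2 * z)) z :=
    (hasDerivAt_id z).mul (hq.sub_const 1)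
  have hp' : HasDerivAt (fun x : ℂ => 3 * x ^ 2 - 1) (3 * (2 * z)) z :=
    (hq.const_mul 3).sub_const 1
  have hp'' : HasDerivAt (fun x : ℂ => 6 * x) (6 * 1) z := (hasDerivAt_id z).const_mul 6
  have hL := (hp.mul hp'').div (hp'.pow 2) (pow_ne_zero 2 h)
  have hC := (hasDerivAt_id z).sub (((hL.div_const 2).const_add 1).mul (hp.div hp' h))
  rw [funext cheb_cubic]
  refine hC.congr_deriv ?_
  have h' : z ^ 2 * 3 - 1 ≠ 0 := by rwa [mul_comm]
  simp only [Pi.mul_apply, Pi.div_apply, Pi.pow_apply]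
  field_simp
  ring

theorem exists_pos_real_sq_eq {z : ℂ} (hz : 12 * z ^ 4 - 9 * z ^ 2 + 1 = 0) :
    ∃ w : ℝ, 0 < w ∧ z ^ 2 = (w : ℂ) := by
  have hs : (√33 : ℝ) ^ 2 = 33 := Real.sq_sqrt (by norm_num)
  have hsc : ((√33 : ℝ) : ℂ) ^ 2 = 33 := by exact_mod_cast hs
  have hs0 : (0 : ℝ) ≤ √33 := Real.sqrt_nonneg 33
  have hf : (24 * z ^ 2 - 9 - (√33 : ℝ)) * (24 * z ^ 2 - 9 + (√33 : ℝ)) = 0 := by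
    linear_combination 48 * hz - hsc
  rcases mul_eq_zero.mp hf with h | h
  · refine ⟨(9 + √33) / 24, by positivity, ?_⟩
    push_cast
    linear_combination h / 24
  · refine ⟨(9 - √33) / 24, by nlinarith, ?_⟩
    push_cast
    linear_combination h / 24

/-- For `p(z) = z(z²-1)`, any solution `z` of `12z⁴ - 9z² + 1 = 0` satisfies
`3z² - 1 ≠ 0`, is a fixed point of `C_p`, and its multiplier
`C_p'(z) = 5 + 1/(3z²)` is real and `> 1`; all extraneous fixed points are
repelling. -/
theorem extraneous_fixed_points_repelling_cubic (p : Polynomial ℂ)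
    (hp : p = X * (X ^ 2 - 1)) (z : ℂ)
    (hz : 12 * z ^ 4 - 9 * z ^ 2 + 1 = 0) :
    3 * z ^ 2 - 1 ≠ 0
      ∧ cheb p z = z
      ∧ HasDerivAt (cheb p) (5 + 1 / (3 * z ^ 2)) z
      ∧ ∃ r : ℝ, (5 + 1 / (3 * z ^ 2) : ℂ) = (r : ℂ) ∧ 1 < r := by
  subst hp
  have h : 3 * z ^ 2 - 1 ≠ 0 := fun h => by
    have : (2 : ℂ) = 0 := by
      linear_combination (4 * z ^ 2 - 5 / 3) * 3 * h - 3 * hz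
    norm_num at this
  obtain ⟨w, hw, hzw⟩ := exists_pos_real_sq_eq hz
  have hz2 : z ^ 2 ≠ 0 := by
    rw [hzw]
    exact_mod_cast hw.ne'
  have hz0 : z ≠ 0 := fun h => hz2 (by simp [h])
  refine ⟨h, ?_, ?_, 5 + 1 / (3 * w), ?_, ?_⟩
  · have hL : 1 + (z * (z ^ 2 - 1) * (6 * z) / (3 * z ^ 2 - 1) ^ 2) / 2 = 0 := by
      have h' : z ^ 2 * 3 - 1 ≠ 0 := by rwa [mul_comm]
      field_simp
      linear_combination 2 * hz
    rw [cheb_cubic, hL, zero_mul, sub_zero]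
  · refine (hasDerivAt_cheb_cubic h).congr_deriv ?_
    rw [div_eq_iff (pow_ne_zero 4 h)]
    field_simp
    linear_combination
      (15 * z ^ 2 + 1) * (3 * z ^ 2 * (z ^ 2 - 1) - (3 * z ^ 2 - 1) ^ 2) * hz
  · rw [hzw]
    push_cast
    rfl
  · have : 0 < 1 / (3 * w) := by positivity
    linarith
end

section
/- Define φ : ℝ → ℝ by φ(y) = y(42y⁶ + 51y⁴ + 20y² + 3)/(8(2y² + 1)³). Then for every y ∈ ℝ, the sequence of iterates φ^n(y) converges to 0 as n → ∞. (Since C_p(iy) = i·φ(y) for p(z) = z²(z² − 1), this shows the entire imaginary axis lies in the basin of attraction of the fixed point 0 of the Chebyshev's method of p.) -/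
/-- A self-map of `ℝ` that contracts the absolute value by a factor `c < 1` has all its iterates
tending to `0`. -/
theorem tendsto_iterate_zero_of_abs_le_mul {f : ℝ → ℝ} {c : ℝ} (hc₀ : 0 ≤ c) (hc₁ : c < 1)
    (hf : ∀ y, |f y| ≤ c * |y|) (y : ℝ) :
    Filter.Tendsto (fun n => f^[n] y) Filter.atTop (nhds 0) := by
  have hbound : ∀ n : ℕ, |f^[n] y| ≤ c ^ n * |y| := by
    intro n
    induction n with
    | zero => simp
    | succ n ih =>
      rw [Function.iterate_succ_apply']
      calc |f (f^[n] y)| ≤ c * |f^[n] y| := hf _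
        _ ≤ c * (c ^ n * |y|) := by gcongr
        _ = c ^ (n + 1) * |y| := by ring
  refine squeeze_zero_norm hbound ?_
  simpa using (tendsto_pow_atTop_nhds_zero_of_lt_one hc₀ hc₁).mul_const |y|

/-- For `φ(y) = y(42y⁶ + 51y⁴ + 20y² + 3)/(8(2y² + 1)³)` (the imaginary-axis
restriction of Chebyshev's method of `p(z) = z²(z²-1)`), the iterates of every
real `y` converge to `0`. -/
theorem iterates_tendsto_zero_imaginary_axis_quartic (φ : ℝ → ℝ)
    (hφ : ∀ y : ℝ, φ y = y * (42 * y ^ 6 + 51 * y ^ 4 + 20 * y ^ 2 + 3)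
        / (8 * (2 * y ^ 2 + 1) ^ 3)) :
    ∀ y : ℝ, Filter.Tendsto (fun n => φ^[n] y) Filter.atTop (nhds 0) := by
  refine tendsto_iterate_zero_of_abs_le_mul (c := 3 / 4) (by norm_num) (by norm_num) fun y => ?_
  have hnum : 0 ≤ 42 * y ^ 6 + 51 * y ^ 4 + 20 * y ^ 2 + 3 := by positivity
  have hden : 0 < 8 * (2 * y ^ 2 + 1) ^ 3 := by positivity
  have hratio : (42 * y ^ 6 + 51 * y ^ 4 + 20 * y ^ 2 + 3) / (8 * (2 * y ^ 2 + 1) ^ 3) ≤ 3 / 4 := by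
    rw [div_le_iff₀ hden]
    have : 0 ≤ 6 * y ^ 6 + 21 * y ^ 4 + 16 * y ^ 2 + 3 := by positivity
    linarith
  rw [hφ, mul_div_assoc, abs_mul, abs_of_nonneg (div_nonneg hnum hden.le), mul_comm]
  gcongr
end

section
/- Let p(z) = z²(z² − 1) and let z ∈ ℂ satisfy 22z⁴ − 23z² + 5 = 0. Then p'(z) = 2z(2z² − 1) ≠ 0, z is a fixed point of the Chebyshev's method of p (i.e. C_p(z) = z), and its multiplier C_p'(z) is a real number strictly greater than 1; in particular all extraneous fixed points of C_p are repelling. -/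
open Polynomial

lemma cheb_quartic (x : ℂ) :
    cheb (X ^ 2 * (X ^ 2 - 1)) x
      = x - (22 * x ^ 4 - 23 * x ^ 2 + 5) * (x * (x ^ 2 - 1)) / (8 * (2 * x ^ 2 - 1) ^ 3) := by
  have h1 : eval x (derivative (X ^ 2 * (X ^ 2 - 1) : ℂ[X])) = 2 * x * (2 * x ^ 2 - 1) := by
    simp; ring
  have h2 : eval x (derivative (derivative (X ^ 2 * (X ^ 2 - 1) : ℂ[X]))) = 12 * x ^ 2 - 2 := by
    simp; ring
  have h0 : eval x (X ^ 2 * (X ^ 2 - 1) : ℂ[X]) = x ^ 2 * (x ^ 2 - 1) := by simp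
  rw [cheb, h0, h1, h2]
  by_cases hx : x = 0
  · simp [hx]
  by_cases hd : 2 * x ^ 2 - 1 = 0
  · simp [hd]
  generalize hd' : 2 * x ^ 2 - 1 = d at hd ⊢
  field_simp
  rw [← hd']
  ring

lemma hasDerivAt_cheb_quartic {z : ℂ} (hz : 22 * z ^ 4 - 23 * z ^ 2 + 5 = 0)
    (hd : 2 * z ^ 2 - 1 ≠ 0) :
    HasDerivAt (cheb (X ^ 2 * (X ^ 2 - 1)))
      (1 - (44 * z ^ 2 - 23) * (z ^ 2 * (z ^ 2 - 1)) / (4 * (2 * z ^ 2 - 1) ^ 3)) z := by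
  rw [funext cheb_quartic]
  have hq : HasDerivAt (fun x : ℂ ↦ 22 * x ^ 4 - 23 * x ^ 2 + 5)
      (22 * (4 * z ^ 3) - 23 * (2 * z)) z := by
    simpa using (((hasDerivAt_pow 4 z).const_mul 22).sub
      ((hasDerivAt_pow 2 z).const_mul 23)).add_const 5
  have hg : DifferentiableAt ℂ (fun x : ℂ ↦ x * (x ^ 2 - 1) / (8 * (2 * x ^ 2 - 1) ^ 3)) z := by
    refine DifferentiableAt.div (by fun_prop) (by fun_prop) ?_
    exact mul_ne_zero (by norm_num) (pow_ne_zero 3 hd)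
  simp only [mul_div_assoc (22 * _ ^ 4 - 23 * _ ^ 2 + 5 : ℂ)]
  refine ((hasDerivAt_id' z).sub (hq.mul hg.hasDerivAt)).congr_deriv ?_
  rw [hz]
  field_simp
  ring

lemma exists_real_sq_eq_of_quartic {z : ℂ} (hz : 22 * z ^ 4 - 23 * z ^ 2 + 5 = 0) :
    ∃ s : ℝ, s ^ 2 = 89 ∧ z ^ 2 = (23 + (s : ℂ)) / 44 := by
  have hs : ((√89 : ℝ) : ℂ) ^ 2 = 89 := by
    rw [← Complex.ofReal_pow, Real.sq_sqrt (by norm_num)]; norm_num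
  have h : (44 * z ^ 2 - 23) ^ 2 = ((√89 : ℝ) : ℂ) ^ 2 := by
    rw [hs]; linear_combination 88 * hz
  rcases sq_eq_sq_iff_eq_or_eq_neg.mp h with h | h
  · exact ⟨√89, Real.sq_sqrt (by norm_num), by linear_combination h / 44⟩
  · exact ⟨-√89, by rw [neg_sq, Real.sq_sqrt (by norm_num)],
      by push_cast; linear_combination h / 44⟩

/-- For `p(z) = z²(z²-1)`, any solution `z` of `22z⁴ - 23z² + 5 = 0` satisfies
`p'(z) = 2z(2z²-1) ≠ 0`, is a fixed point of `C_p`, and its multiplier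
`C_p'(z)` is a real number `> 1`; all extraneous fixed points are repelling. -/
theorem extraneous_fixed_points_repelling_quartic (p : Polynomial ℂ)
    (hp : p = X ^ 2 * (X ^ 2 - 1)) (z : ℂ)
    (hz : 22 * z ^ 4 - 23 * z ^ 2 + 5 = 0) :
    eval z (derivative p) = 2 * z * (2 * z ^ 2 - 1)
      ∧ 2 * z * (2 * z ^ 2 - 1) ≠ 0
      ∧ cheb p z = z
      ∧ ∃ μ : ℂ, HasDerivAt (cheb p) μ z ∧ ∃ r : ℝ, μ = (r : ℂ) ∧ 1 < r := by
  subst hp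
  have hz0 : z ≠ 0 := by
    rintro rfl
    norm_num at hz
  have hd : 2 * z ^ 2 - 1 ≠ 0 := by
    intro h
    have : (1 : ℂ) = 0 := by
      linear_combination (11 * z ^ 2 - 6) * h - hz
    exact one_ne_zero this
  refine ⟨by simp; ring, by simp [hz0, hd], by simp [cheb_quartic, hz], _,
    hasDerivAt_cheb_quartic hz hd, ?_⟩
  obtain ⟨s, hs, hzs⟩ := exists_real_sq_eq_of_quartic hz
  refine ⟨1 - s * ((23 + s) / 44 * ((23 + s) / 44 - 1)) / (4 * (2 * ((23 + s) / 44) - 1) ^ 3),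
    ?_, ?_⟩
  · rw [hzs]
    push_cast
    congr 3
    ring
  · have hs10 : |s| < 10 := abs_lt_of_sq_lt_sq (by rw [hs]; norm_num) (by norm_num)
    obtain ⟨hl, hu⟩ := abs_lt.mp hs10
    have hden : 2 * ((23 + s) / 44) - 1 = (1 + s) / 22 := by ring
    have hnum : (23 + s) / 44 * ((23 + s) / 44 - 1) = (s - 197) / 968 := by
      linear_combination hs / 1936
    rw [hden, hnum, lt_sub_comm, sub_self]
    rcases lt_or_ge s 0 with h | h
    · refine div_neg_of_pos_of_neg (mul_pos_of_neg_of_neg h (by linarith)) ?_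
      have : (1 + s) / 22 < 0 := by nlinarith
      exact mul_neg_of_pos_of_neg four_pos (Odd.pow_neg (by decide) this)
    · have hpos : 0 < s := by nlinarith
      refine div_neg_of_neg_of_pos (mul_neg_of_pos_of_neg hpos (by linarith)) ?_
      positivity
end

section
/- Define F : ℝ → ℝ by F(x) = 3x⁴(14x⁶ − 4x³ − 1)/(4x³ − 1)³. Then for every real x ≤ 0, the sequence of iterates F^n(x) converges to 0 as n → ∞, and for every real x ≥ 1, the sequence of iterates F^n(x) converges to 1 as n → ∞. (F is the restriction to the real line of the Chebyshev's method applied to p(z) = z(z³ − 1); hence (−∞, 0] lies in the basin of 0 and [1, ∞) lies in the immediate basin of 1.) -/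
/-- If `s` is mapped into itself by `f` and `f` contracts distances to `a` on `s` by a
factor `c < 1`, then the iterates of every point of `s` converge to `a`. -/
theorem tendsto_iterate_of_dist_le_mul {X : Type*} [PseudoMetricSpace X] {f : X → X} {s : Set X}
    {a : X} {c : ℝ} (hc₀ : 0 ≤ c) (hc₁ : c < 1) (hs : Set.MapsTo f s s)
    (hf : ∀ x ∈ s, dist (f x) a ≤ c * dist x a) {x : X} (hx : x ∈ s) :
    Filter.Tendsto (fun n => f^[n] x) Filter.atTop (nhds a) := by
  have bound : ∀ n, dist (f^[n] x) a ≤ c ^ n * dist x a := by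
    intro n
    induction n with
    | zero => simp
    | succ n ih =>
      rw [Function.iterate_succ_apply']
      calc dist (f (f^[n] x)) a ≤ c * dist (f^[n] x) a := hf _ (hs.iterate n hx)
        _ ≤ c * (c ^ n * dist x a) := by gcongr
        _ = c ^ (n + 1) * dist x a := by ring
  rw [tendsto_iff_dist_tendsto_zero]
  refine squeeze_zero (fun _ => dist_nonneg) bound ?_
  simpa using (tendsto_pow_atTop_nhds_zero_of_lt_one hc₀ hc₁).mul_const (dist x a)

/-- The real restriction of Chebyshev's method applied to `z (z³ - 1)`. -/
noncomputable def chebyshevQuartic (x : ℝ) : ℝ :=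
  3 * x ^ 4 * (14 * x ^ 6 - 4 * x ^ 3 - 1) / (4 * x ^ 3 - 1) ^ 3

theorem chebyshevQuartic_neg (y : ℝ) :
    chebyshevQuartic (-y)
      = 3 * y ^ 4 * (1 - 4 * y ^ 3 - 14 * y ^ 6) / (4 * y ^ 3 + 1) ^ 3 := by
  have h : (4 * (-y) ^ 3 - 1) ^ 3 = -(4 * y ^ 3 + 1) ^ 3 := by ring
  rw [chebyshevQuartic, h, div_neg, ← neg_div]
  ring

theorem chebyshevQuartic_neg_le {y : ℝ} (hy : 0 ≤ y) : chebyshevQuartic (-y) ≤ 2 / 5 := by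
  rw [chebyshevQuartic_neg, div_le_iff₀ (by positivity)]
  have h₃ : 0 ≤ y ^ 3 := by positivity
  have h₆ : 0 ≤ y ^ 6 := by positivity
  have h₉ : 0 ≤ y ^ 9 := by positivity
  have h₁₀ : 0 ≤ y ^ 10 := by positivity
  rcases le_total y 1 with h | h
  · have h₄ : y ^ 4 ≤ y ^ 3 := pow_le_pow_of_le_one hy h (by norm_num)
    have h₇ : 0 ≤ y ^ 7 := by positivity
    nlinarith
  · have h₇ : y ^ 4 ≤ y ^ 7 := pow_le_pow_right₀ h (by norm_num)
    nlinarith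

theorem abs_chebyshevQuartic_neg_le {y : ℝ} (hy : 0 ≤ y) :
    |chebyshevQuartic (-y)| ≤ 7 / 10 * y := by
  rw [chebyshevQuartic_neg, abs_le, ← neg_mul, le_div_iff₀ (by positivity),
    div_le_iff₀ (by positivity)]
  have h₄ : 0 ≤ y ^ 4 := by positivity
  have h₇ : 0 ≤ y ^ 7 := by positivity
  have h₁₀ : 0 ≤ y ^ 10 := by positivity
  constructor <;> linarith

theorem chebyshevQuartic_mem_Icc {x : ℝ} (h₀ : 0 ≤ x) (h₁ : x ≤ 2 / 5) :
    chebyshevQuartic x ∈ Set.Icc 0 (7 / 10 * x) := by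
  have hu₀ : 0 ≤ x ^ 3 := by positivity
  have hu₁ : x ^ 3 ≤ 8 / 125 := (pow_le_pow_left₀ h₀ h₁ 3).trans (by norm_num)
  have hF : chebyshevQuartic x
      = x * (3 * x ^ 3 * (1 + 4 * x ^ 3 - 14 * (x ^ 3) ^ 2) / (1 - 4 * x ^ 3) ^ 3) := by
    have h : (4 * x ^ 3 - 1) ^ 3 = -(1 - 4 * x ^ 3) ^ 3 := by ring
    rw [chebyshevQuartic, h, div_neg, ← neg_div]
    ring
  rw [hF]
  generalize x ^ 3 = u at hu₀ hu₁
  have hden : (93 / 125 : ℝ) ^ 3 ≤ (1 - 4 * u) ^ 3 :=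
    pow_le_pow_left₀ (by norm_num) (by linarith) 3
  have hpos : 0 < (1 - 4 * u) ^ 3 := lt_of_lt_of_le (by norm_num) hden
  have hnum : 0 ≤ 1 + 4 * u - 14 * u ^ 2 := by nlinarith
  constructor
  · positivity
  · rw [mul_comm (7 / 10)]
    refine mul_le_mul_of_nonneg_left ?_ h₀
    rw [div_le_iff₀ hpos]
    nlinarith [mul_nonneg hu₀ (sq_nonneg u)]

theorem chebyshevQuartic_sub_one_mem_Icc {x : ℝ} (hx : 1 ≤ x) :
    chebyshevQuartic x - 1 ∈ Set.Icc 0 (7 / 10 * (x - 1)) := by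
  obtain ⟨t, ht, rfl⟩ : ∃ t, 0 ≤ t ∧ x = 1 + t := ⟨x - 1, by linarith, by ring⟩
  have hu : 1 ≤ (1 + t) ^ 3 := one_le_pow₀ hx
  have hpos : 0 < (4 * (1 + t) ^ 3 - 1) ^ 3 := pow_pos (by linarith) 3
  rw [Set.mem_Icc, sub_nonneg, sub_le_iff_le_add, chebyshevQuartic, le_div_iff₀ hpos,
    div_le_iff₀ hpos]
  constructor <;> rw [← sub_nonneg] <;> ring_nf <;> positivity

theorem tendsto_iterate_chebyshevQuartic_zero {x : ℝ} (hx : x ≤ 0) :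
    Filter.Tendsto (fun n => chebyshevQuartic^[n] x) Filter.atTop (nhds 0) := by
  have key : ∀ z ≤ (2 / 5 : ℝ),
      chebyshevQuartic z ≤ 2 / 5 ∧ |chebyshevQuartic z| ≤ 7 / 10 * |z| := by
    intro z hz
    rcases le_total 0 z with h | h
    · obtain ⟨h₁, h₂⟩ := chebyshevQuartic_mem_Icc h hz
      rw [abs_of_nonneg h₁, abs_of_nonneg h]
      exact ⟨by linarith, h₂⟩
    · rw [abs_of_nonpos h]
      have h' : 0 ≤ -z := by linarith
      simpa only [neg_neg] using
        And.intro (chebyshevQuartic_neg_le h') (abs_chebyshevQuartic_neg_le h')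
  refine tendsto_iterate_of_dist_le_mul (s := Set.Iic (2 / 5)) (c := 7 / 10) (by norm_num)
    (by norm_num) (fun z hz => (key z hz).1) (fun z hz => ?_) (Set.mem_Iic.2 (by linarith))
  simpa only [Real.dist_0_eq_abs] using (key z hz).2

theorem tendsto_iterate_chebyshevQuartic_one {x : ℝ} (hx : 1 ≤ x) :
    Filter.Tendsto (fun n => chebyshevQuartic^[n] x) Filter.atTop (nhds 1) := by
  refine tendsto_iterate_of_dist_le_mul (s := Set.Ici 1) (c := 7 / 10) (by norm_num)
    (by norm_num) (fun z hz => sub_nonneg.1 (chebyshevQuartic_sub_one_mem_Icc hz).1)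
    (fun z hz => ?_) hx
  obtain ⟨h₁, h₂⟩ := chebyshevQuartic_sub_one_mem_Icc hz
  rwa [Real.dist_eq, Real.dist_eq, abs_of_nonneg h₁, abs_of_nonneg (sub_nonneg.2 hz)]

/-- For `F(x) = 3x⁴(14x⁶ - 4x³ - 1)/(4x³ - 1)³` (the real restriction of
Chebyshev's method of `p(z) = z(z³-1)`), the iterates of every `x ≤ 0`
converge to `0`, and the iterates of every `x ≥ 1` converge to `1`. -/
theorem iterates_tendsto_quartic (F : ℝ → ℝ)
    (hF : ∀ x : ℝ, F x = 3 * x ^ 4 * (14 * x ^ 6 - 4 * x ^ 3 - 1)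
        / (4 * x ^ 3 - 1) ^ 3) :
    (∀ x : ℝ, x ≤ 0 →
        Filter.Tendsto (fun n => F^[n] x) Filter.atTop (nhds 0))
      ∧ (∀ x : ℝ, 1 ≤ x →
        Filter.Tendsto (fun n => F^[n] x) Filter.atTop (nhds 1)) := by
  obtain rfl : F = chebyshevQuartic := funext hF
  exact ⟨fun _ => tendsto_iterate_chebyshevQuartic_zero,
    fun _ => tendsto_iterate_chebyshevQuartic_one⟩
end
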